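/- arXiv:hep-th/9312065 — 2 statements merged into one kernel-verified Lean document; each statement's English description precedes it below -/
import Mathlib

section
/- Let g be a finite-dimensional simple Lie algebra over the complex numbers, x a nonzero element of g, and N a positive integer. Then the quotient of the universal enveloping algebra U(g) by the two-sided ideal generated by x^N is finite-dimensional, of dimension at most N^(dim g). -/
/-- The pairs `(u, v)` of curves in a complex vector space such that `u` is a finite sum of terms
`f t • a` with `f` entire, and `v` is the derivative of `u` computed termwise. -/
def derivPairs (V : Type*) [AddCommGroup V] [Module ℂ V] : Submodule ℂ ((ℂ → V) × (ℂ → V)) :=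
  Submodule.span ℂ {p | ∃ (f f' : ℂ → ℂ) (a : V), (∀ t, HasDerivAt f (f' t) t) ∧
    p = (fun t => f t • a, fun t => f' t • a)}

section derivPairs

variable {V W : Type*} [AddCommGroup V] [Module ℂ V] [AddCommGroup W] [Module ℂ W]

theorem smul_mem_derivPairs {f f' : ℂ → ℂ} (hf : ∀ t, HasDerivAt f (f' t) t) (a : V) :
    ((fun t => f t • a, fun t => f' t • a) : (ℂ → V) × (ℂ → V)) ∈ derivPairs V :=
  Submodule.subset_span ⟨f, f', a, hf, rfl⟩

theorem const_mem_derivPairs (a : V) :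
    ((fun _ => a, fun _ => 0) : (ℂ → V) × (ℂ → V)) ∈ derivPairs V := by
  simpa using smul_mem_derivPairs (fun t => hasDerivAt_const t (1 : ℂ)) a

theorem map_mem_derivPairs (φ : V →ₗ[ℂ] W) {p : (ℂ → V) × (ℂ → V)} (hp : p ∈ derivPairs V) :
    ((fun t => φ (p.1 t), fun t => φ (p.2 t)) : (ℂ → W) × (ℂ → W)) ∈ derivPairs W := by
  induction hp using Submodule.span_induction with
  | mem p hp =>
    obtain ⟨f, f', a, hf, rfl⟩ := hp
    simpa using smul_mem_derivPairs hf (φ a)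
  | zero =>
    simp only [Prod.fst_zero, Prod.snd_zero, Pi.zero_apply, map_zero]
    exact (derivPairs W).zero_mem
  | add p q _ _ hp hq => simpa [Pi.add_def] using (derivPairs W).add_mem hp hq
  | smul c p _ hp => simpa [Pi.smul_def] using (derivPairs W).smul_mem c hp

theorem hasDerivAt_of_mem_derivPairs (ψ : V →ₗ[ℂ] ℂ) {p : (ℂ → V) × (ℂ → V)}
    (hp : p ∈ derivPairs V) (t : ℂ) : HasDerivAt (fun s => ψ (p.1 s)) (ψ (p.2 t)) t := by
  induction hp using Submodule.span_induction with
  | mem p hp =>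
    obtain ⟨f, f', a, hf, rfl⟩ := hp
    simpa using (hf t).mul_const (ψ a)
  | zero => simpa using hasDerivAt_const t (0 : ℂ)
  | add p q _ _ hp hq => simpa [Pi.add_def] using hp.add hq
  | smul c p _ hp => simpa using hp.const_mul c

theorem mul_mem_derivPairs {A : Type*} [Ring A] [Algebra ℂ A] {p q : (ℂ → A) × (ℂ → A)}
    (hp : p ∈ derivPairs A) (hq : q ∈ derivPairs A) :
    (p.1 * q.1, p.2 * q.1 + p.1 * q.2) ∈ derivPairs A := by
  induction hp, hq using Submodule.span_induction₂ with
  | mem_mem p q hp hq =>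
    obtain ⟨f, f', a, hf, rfl⟩ := hp
    obtain ⟨h, h', b, hh, rfl⟩ := hq
    convert smul_mem_derivPairs (fun t => (hf t).mul (hh t)) (a * b) using 2
    · ext t; simp [smul_smul, mul_comm]
    · ext t; simp [smul_smul, add_smul, mul_comm]
  | zero_left q _ => simp [← Prod.zero_eq_mk]
  | zero_right p _ => simp [← Prod.zero_eq_mk]
  | add_left p q r _ _ _ hp hq =>
    convert (derivPairs A).add_mem hp hq using 1
    ext t <;> simp [add_mul]; abel
  | add_right p q r _ _ _ hp hq =>
    convert (derivPairs A).add_mem hp hq using 1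
    ext t <;> simp [mul_add]; abel
  | smul_left c p q _ _ h =>
    convert (derivPairs A).smul_mem c h using 1
    ext t <;> simp
  | smul_right c p q _ _ h =>
    convert (derivPairs A).smul_mem c h using 1
    ext t <;> simp

/-- If the derivative of `u` is `[y, u]`, then that of `u ^ n` is `[y, u ^ n]`. -/
theorem pow_mem_derivPairs {A : Type*} [Ring A] [Algebra ℂ A] (y : A) {u : ℂ → A}
    (hu : (u, fun t => y * u t - u t * y) ∈ derivPairs A) (n : ℕ) :
    (u ^ n, fun t => y * u t ^ n - u t ^ n * y) ∈ derivPairs A := by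
  induction n with
  | zero => simpa [Pi.one_def] using const_mem_derivPairs (1 : A)
  | succ n ih =>
    convert mul_mem_derivPairs ih hu using 2
    · exact pow_succ u n
    · ext t
      simp only [Pi.add_apply, Pi.mul_apply, Pi.pow_apply, pow_succ]
      noncomm_ring

/-- Existence of a global solution of a linear differential equation with constant coefficients. -/
theorem exists_curve_mem_derivPairs [FiniteDimensional ℂ V] (D : Module.End ℂ V) (x : V) :
    ∃ z : ℂ → V, z 0 = x ∧ (z, fun t => D (z t)) ∈ derivPairs V := by
  let b := Module.finBasis ℂ V
  let e := b.equivFun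
  let A : (Fin (Module.finrank ℂ V) → ℂ) →L[ℂ] (Fin (Module.finrank ℂ V) → ℂ) :=
    LinearMap.toContinuousLinearMap (e.toLinearMap ∘ₗ D ∘ₗ e.symm.toLinearMap)
  let c : ℂ → Fin (Module.finrank ℂ V) → ℂ := fun t => NormedSpace.exp (t • A) (e x)
  have hc (t : ℂ) : HasDerivAt c (A (c t)) t := by
    simpa using (hasDerivAt_exp_smul_const' A t).clm_apply (hasDerivAt_const t (e x))
  have hsum : (∑ i, ((fun t => c t i • b i, fun t => A (c t) i • b i) : (ℂ → V) × (ℂ → V)))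
      ∈ derivPairs V :=
    Submodule.sum_mem _ fun i _ => smul_mem_derivPairs (fun t => hasDerivAt_pi.1 (hc t) i) (b i)
  refine ⟨fun t => e.symm (c t), by simp [c, zero_smul ℂ A], ?_⟩
  convert hsum using 1
  ext t
  · simp [Prod.fst_sum, e, Module.Basis.equivFun_symm_apply]
  · have : D (e.symm (c t)) = e.symm (A (c t)) := by simp [A]
    rw [Prod.snd_sum]
    simp only [this, Finset.sum_apply]
    simp [e, Module.Basis.equivFun_symm_apply]

/-- A subspace stable under `D` contains every curve `u` with derivative `D u` starting in it. -/
theorem mem_of_mem_derivPairs (S : Submodule ℂ V) (D : Module.End ℂ V)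
    (hD : ∀ v ∈ S, D v ∈ S) {u : ℂ → V} (hu : (u, fun t => D (u t)) ∈ derivPairs V)
    (h0 : u 0 ∈ S) (t : ℂ) : u t ∈ S := by
  rw [← Submodule.Quotient.mk_eq_zero, ← Module.forall_dual_apply_eq_zero_iff ℂ]
  intro ψ
  let ξ : V →ₗ[ℂ] ℂ := ψ ∘ₗ S.mkQ
  have hderiv (k : ℕ) : iteratedDeriv k (fun s => ξ (u s)) = fun s => ξ ((D ^ k) (u s)) := by
    induction k with
    | zero => simp
    | succ k ih =>
      ext s
      rw [iteratedDeriv_succ, ih]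
      simpa [pow_succ] using (hasDerivAt_of_mem_derivPairs (ξ ∘ₗ D ^ k) hu s).deriv
  have hmem (k : ℕ) : (D ^ k) (u 0) ∈ S := by
    induction k with
    | zero => simpa
    | succ k ih => simpa [pow_succ'] using hD _ ih
  have hdiff : Differentiable ℂ fun s => ξ (u s) := fun s =>
    (hasDerivAt_of_mem_derivPairs ξ hu s).differentiableAt
  have htaylor := Complex.taylorSeries_eq_of_entire' 0 t hdiff
  have hzero (k : ℕ) : ξ ((D ^ k) (u 0)) = 0 := by
    simp [ξ, (Submodule.Quotient.mk_eq_zero S).2 (hmem k)]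
  change ξ (u t) = 0
  simpa only [hderiv, hzero, smul_zero, mul_zero, zero_mul, tsum_zero] using htaylor.symm

/-- The derivative of a curve in a subspace belongs to the subspace. -/
theorem snd_mem_of_mem_derivPairs (S : Submodule ℂ V) {p : (ℂ → V) × (ℂ → V)}
    (hp : p ∈ derivPairs V) (hS : ∀ t, p.1 t ∈ S) (t : ℂ) : p.2 t ∈ S := by
  rw [← Submodule.Quotient.mk_eq_zero, ← Module.forall_dual_apply_eq_zero_iff ℂ]
  intro ψ
  have h := hasDerivAt_of_mem_derivPairs (ψ ∘ₗ S.mkQ) hp t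
  have hzero (s : ℂ) : (ψ ∘ₗ S.mkQ) (p.1 s) = 0 := by
    simp [(Submodule.Quotient.mk_eq_zero S).2 (hS s)]
  simp only [hzero] at h
  exact h.unique (hasDerivAt_const t 0)

end derivPairs

section enveloping

open UniversalEnvelopingAlgebra

attribute [local instance] LieRing.ofAssociativeRing

/-- In a simple Lie algebra, the elements whose `N`-th power lies in a two-sided ideal of the
enveloping algebra span the whole Lie algebra as soon as one of them is nonzero. -/
theorem span_setOf_pow_mem_eq_top {g : Type*} [LieRing g] [LieAlgebra ℂ g] [FiniteDimensional ℂ g]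
    [LieAlgebra.IsSimple ℂ g] (I : TwoSidedIdeal (UniversalEnvelopingAlgebra ℂ g)) {N : ℕ} {x : g}
    (hx : x ≠ 0) (hxI : ι ℂ x ^ N ∈ I) :
    Submodule.span ℂ {z : g | ι ℂ z ^ N ∈ I} = ⊤ := by
  set S := Submodule.span ℂ {z : g | ι ℂ z ^ N ∈ I} with hS
  have hlie (y z : g) (hz : ι ℂ z ^ N ∈ I) : ⁅y, z⁆ ∈ S := by
    obtain ⟨u, rfl, hu⟩ := exists_curve_mem_derivPairs (LieAlgebra.ad ℂ g y : Module.End ℂ g) z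
    have hιu : (fun t => ι ℂ (u t),
        fun t => ι ℂ y * ι ℂ (u t) - ι ℂ (u t) * ι ℂ y) ∈ derivPairs _ := by
      simpa [-ι_apply, LieRing.of_associative_ring_bracket] using
        map_mem_derivPairs (ι ℂ : g →ₗ⁅ℂ⁆ UniversalEnvelopingAlgebra ℂ g).toLinearMap hu
    have hpow := pow_mem_derivPairs _ hιu N
    have hmem (t : ℂ) : ι ℂ (u t) ^ N ∈ I := by
      refine mem_of_mem_derivPairs (Submodule.restrictScalars ℂ I.asIdeal)
        (LinearMap.mulLeft ℂ (ι ℂ y) - LinearMap.mulRight ℂ (ι ℂ y)) ?_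
        (u := (fun t => ι ℂ (u t)) ^ N) ?_ hz t
      · intro v hv
        exact I.sub_mem (I.mul_mem_left _ _ hv) (I.mul_mem_right _ _ hv)
      · simpa [-ι_apply] using hpow
    simpa using snd_mem_of_mem_derivPairs S hu (fun t => Submodule.subset_span (hmem t)) 0
  let J : LieIdeal ℂ g :=
    { S with
      lie_mem := by
        intro y z hz
        change z ∈ S at hz
        change ⁅y, z⁆ ∈ S
        induction hz using Submodule.span_induction with
        | mem z hz => exact hlie y z hz
        | zero => simp
        | add z w _ _ hz hw => simpa using S.add_mem hz hw
        | smul c z _ hz => simpa using S.smul_mem c hz }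
  have hxJ : x ∈ J := Submodule.subset_span (s := {z : g | ι ℂ z ^ N ∈ I}) hxI
  rcases LieAlgebra.IsSimple.eq_bot_or_eq_top (R := ℂ) J with h | h
  · rw [h] at hxJ
    exact absurd ((LieSubmodule.mem_bot x).1 hxJ) hx
  · exact congrArg LieSubmodule.toSubmodule h

theorem adjoin_range_ι_comp_eq_top {κ g : Type*} [LieRing g] [LieAlgebra ℂ g] {b : κ → g}
    (hb : Submodule.span ℂ (Set.range b) = ⊤) :
    Algebra.adjoin ℂ (Set.range fun i => ι ℂ (b i)) = ⊤ := by
  have hι (z : g) : ι ℂ z ∈ Algebra.adjoin ℂ (Set.range fun i => ι ℂ (b i)) := by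
    have hz : z ∈ Submodule.span ℂ (Set.range b) := hb ▸ Submodule.mem_top
    induction hz using Submodule.span_induction with
    | mem z hz =>
      obtain ⟨i, rfl⟩ := hz
      exact Algebra.subset_adjoin ⟨i, rfl⟩
    | zero => simpa only [map_zero] using zero_mem _
    | add y z _ _ hy hz => simpa only [map_add] using add_mem hy hz
    | smul c z _ hz => simpa only [map_smul] using Subalgebra.smul_mem _ hz c
  have hsurj : Function.Surjective (mkAlgHom ℂ g) := RingCon.mkₐ_surjective _
  rw [eq_top_iff, ← (AlgHom.range_eq_top _).2 hsurj, ← Algebra.map_top,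
    ← TensorAlgebra.adjoin_range_ι, AlgHom.map_adjoin, Algebra.adjoin_le_iff]
  rintro _ ⟨_, ⟨z, rfl⟩, rfl⟩
  exact hι z

theorem commutator_ι_mem_span {κ g : Type*} [LieRing g] [LieAlgebra ℂ g] {b : κ → g}
    (hb : Submodule.span ℂ (Set.range b) = ⊤) (y z : g) :
    ι ℂ y * ι ℂ z - ι ℂ z * ι ℂ y ∈ Submodule.span ℂ (Set.range fun i => ι ℂ (b i)) := by
  rw [← LieRing.of_associative_ring_bracket, ← LieHom.map_lie]
  have h : ⁅y, z⁆ ∈ Submodule.span ℂ (Set.range b) := hb ▸ Submodule.mem_top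
  have := Submodule.mem_map_of_mem
    (f := (ι ℂ : g →ₗ⁅ℂ⁆ UniversalEnvelopingAlgebra ℂ g).toLinearMap) h
  rw [Submodule.map_span, ← Set.range_comp] at this
  exact this

end enveloping

section words

variable {R A ι : Type*} [CommRing R] [Ring A] [Algebra R A]

/-- The span of the products of at most `k` members of the family `a`. -/
def wordSpan (R : Type*) {A ι : Type*} [CommRing R] [Ring A] [Algebra R A] (a : ι → A) (k : ℕ) :
    Submodule R A :=
  Submodule.span R {z | ∃ w : List ι, w.length ≤ k ∧ z = (w.map a).prod}

theorem mul_mem_wordSpan {a : ι → A} {y z : A} {k : ℕ} (hy : y ∈ Submodule.span R (Set.range a))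
    (hz : z ∈ wordSpan R a k) : y * z ∈ wordSpan R a (k + 1) := by
  induction hy, hz using Submodule.span_induction₂ with
  | mem_mem y z hy hz =>
    obtain ⟨i, rfl⟩ := hy
    obtain ⟨w, hw, rfl⟩ := hz
    exact Submodule.subset_span ⟨i :: w, by simpa using hw, by simp⟩
  | zero_left => simp
  | zero_right => simp
  | add_left x y z _ _ _ hx hy => simpa [add_mul] using add_mem hx hy
  | add_right x y z _ _ _ hx hy => simpa [mul_add] using add_mem hx hy
  | smul_left c x y _ _ h => simpa using Submodule.smul_mem _ c h
  | smul_right c x y _ _ h => simpa using Submodule.smul_mem _ c h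

/-- If the commutators of the `a i` are linear combinations of the `a i`, then permuting the factors
of a product of `a i` changes it by a combination of shorter products. -/
theorem prod_sub_prod_mem_wordSpan {a : ι → A}
    (ha : ∀ i j, a i * a j - a j * a i ∈ Submodule.span R (Set.range a)) {w w' : List ι}
    (h : w.Perm w') : (w.map a).prod - (w'.map a).prod ∈ wordSpan R a (w.length - 1) := by
  induction h with
  | nil => simp
  | @cons i l l' h ih =>
    rcases l with _ | ⟨j, l⟩
    · simp [h.nil_eq.symm]
    · simpa [mul_sub] using mul_mem_wordSpan (Submodule.subset_span ⟨i, rfl⟩) ih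
  | swap i j l =>
    have := mul_mem_wordSpan (ha j i)
      (Submodule.subset_span (R := R) ⟨l, le_rfl, rfl⟩ : (l.map a).prod ∈ wordSpan R a l.length)
    simpa [sub_mul, mul_assoc] using this
  | trans h₁ h₂ ih₁ ih₂ =>
    rw [← h₁.length_eq] at ih₂
    simpa using add_mem ih₁ ih₂

/-- Every list of elements of `Fin n` is a permutation of the list which groups equal entries. -/
theorem perm_flatMap_replicate_count {n : ℕ} (w : List (Fin n)) :
    w.Perm ((List.finRange n).flatMap fun i => List.replicate (w.count i) i) := by
  rw [List.perm_iff_count]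
  intro j
  rw [List.count_flatMap, ← List.ofFn_eq_map, List.sum_ofFn]
  simp [List.count_replicate]

theorem prod_map_flatMap_replicate {M : Type*} [Monoid M] {α : Type*} (a : α → M) (e : α → ℕ)
    (l : List α) :
    ((l.flatMap fun i => List.replicate (e i) i).map a).prod =
      (l.map fun i => a i ^ e i).prod := by
  induction l with
  | nil => simp
  | cons i l ih => simp [ih]

theorem TwoSidedIdeal.list_prod_mem (I : TwoSidedIdeal A) {l : List A} {z : A} (hz : z ∈ l)
    (hI : z ∈ I) : l.prod ∈ I := by
  obtain ⟨s, t, rfl⟩ := List.append_of_mem hz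
  simpa using I.mul_mem_left _ _ (I.mul_mem_right _ _ hI)

theorem wordSpan_le {n N : ℕ} {a : Fin n → A} (I : TwoSidedIdeal A)
    (ha : ∀ i j, a i * a j - a j * a i ∈ Submodule.span R (Set.range a))
    (hI : ∀ i, a i ^ N ∈ I) (k : ℕ) :
    wordSpan R a k ≤ Submodule.span R (Set.range fun e : Fin n → Fin N =>
      ((List.finRange n).map fun i => a i ^ (e i : ℕ)).prod) ⊔
        Submodule.restrictScalars R I.asIdeal := by
  induction k using Nat.strong_induction_on with
  | _ k ih =>
    refine Submodule.span_le.2 ?_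
    rintro _ ⟨w, hw, rfl⟩
    set w' := (List.finRange n).flatMap fun i => List.replicate (w.count i) i
    have hperm : w.Perm w' := perm_flatMap_replicate_count w
    have hsub : (w.map a).prod - (w'.map a).prod ∈
        Submodule.span R (Set.range fun e : Fin n → Fin N =>
          ((List.finRange n).map fun i => a i ^ (e i : ℕ)).prod) ⊔
            Submodule.restrictScalars R I.asIdeal := by
      rcases Nat.eq_zero_or_pos w.length with h | h
      · have hw' : w' = [] := List.length_eq_zero_iff.1 (hperm.length_eq ▸ h)
        simp [List.length_eq_zero_iff.1 h, hw']
      · exact ih _ (by lia) (prod_sub_prod_mem_wordSpan ha hperm)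
    refine (Submodule.sub_mem_iff_left _ ?_).1 hsub
    rw [prod_map_flatMap_replicate]
    by_cases h : ∀ i, w.count i < N
    · exact Submodule.mem_sup_left (Submodule.subset_span ⟨fun i => ⟨w.count i, h i⟩, rfl⟩)
    · obtain ⟨i, hi⟩ := not_forall.1 h
      refine Submodule.mem_sup_right
        (I.list_prod_mem (List.mem_map_of_mem (List.mem_finRange i)) ?_)
      rw [← Nat.add_sub_of_le (not_lt.1 hi), pow_add]
      exact I.mul_mem_right _ _ (hI i)

/-- A straightening theorem: if the commutators of the `a i` are linear combinations of the `a i`,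
and the powers `a i ^ N` lie in `I`, then modulo `I` the algebra generated by the `a i` is spanned
by the ordered monomials with exponents less than `N`. -/
theorem span_monomials_sup_eq_top {n N : ℕ} {a : Fin n → A} (I : TwoSidedIdeal A)
    (hgen : Algebra.adjoin R (Set.range a) = ⊤)
    (ha : ∀ i j, a i * a j - a j * a i ∈ Submodule.span R (Set.range a))
    (hI : ∀ i, a i ^ N ∈ I) :
    Submodule.span R (Set.range fun e : Fin n → Fin N =>
      ((List.finRange n).map fun i => a i ^ (e i : ℕ)).prod) ⊔
        Submodule.restrictScalars R I.asIdeal = ⊤ := by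
  rw [eq_top_iff, ← Algebra.top_toSubmodule, ← hgen, Algebra.adjoin_eq_span, Submodule.span_le]
  intro z hz
  obtain ⟨w, rfl⟩ : ∃ w : List (Fin n), z = (w.map a).prod := by
    induction hz using Submonoid.closure_induction with
    | mem z hz =>
      obtain ⟨i, rfl⟩ := hz
      exact ⟨[i], by simp⟩
    | one => exact ⟨[], by simp⟩
    | mul y z _ _ hy hz =>
      obtain ⟨v, rfl⟩ := hy
      obtain ⟨w, rfl⟩ := hz
      exact ⟨v ++ w, by simp⟩
  exact wordSpan_le I ha hI w.length (Submodule.subset_span ⟨w, le_rfl, rfl⟩)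

end words

/-- Let `g` be a finite-dimensional simple Lie algebra over `ℂ`, `x ≠ 0`
an element of `g` and `N` a positive integer.  Then the quotient of the universal
enveloping algebra `U(g)` by the two-sided ideal generated by `x^N` is
finite-dimensional, of dimension at most `N ^ (dim g)`. -/
theorem enveloping_quotient_finiteDimensional
    {g : Type*} [LieRing g] [LieAlgebra ℂ g] [FiniteDimensional ℂ g]
    [LieAlgebra.IsSimple ℂ g]
    (x : g) (hx : x ≠ 0) (N : ℕ) (hN : 0 < N) :
    FiniteDimensional ℂ
      (UniversalEnvelopingAlgebra ℂ g ⧸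
        Submodule.restrictScalars ℂ
          ((TwoSidedIdeal.span {(UniversalEnvelopingAlgebra.ι ℂ x) ^ N}).asIdeal)) ∧
    Module.finrank ℂ
      (UniversalEnvelopingAlgebra ℂ g ⧸
        Submodule.restrictScalars ℂ
          ((TwoSidedIdeal.span {(UniversalEnvelopingAlgebra.ι ℂ x) ^ N}).asIdeal))
      ≤ N ^ (Module.finrank ℂ g) := by
  set I := TwoSidedIdeal.span {UniversalEnvelopingAlgebra.ι ℂ x ^ N}
  have hspan := span_setOf_pow_mem_eq_top I hx (TwoSidedIdeal.subset_span rfl)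
  obtain ⟨b, hbI, hb, -⟩ :=
    Submodule.exists_fun_fin_finrank_span_eq ℂ {z : g | UniversalEnvelopingAlgebra.ι ℂ z ^ N ∈ I}
  replace hb := hb.trans hspan
  have hn : Module.finrank ℂ
      (Submodule.span ℂ {z : g | UniversalEnvelopingAlgebra.ι ℂ z ^ N ∈ I}) =
        Module.finrank ℂ g := by rw [hspan, finrank_top]
  rw [← hn]
  have htop := span_monomials_sup_eq_top (N := N) I (adjoin_range_ι_comp_eq_top hb)
    (fun i j => commutator_ι_mem_span hb (b i) (b j)) hbI
  have hquot := congrArg (Submodule.map (Submodule.restrictScalars ℂ I.asIdeal).mkQ) htop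
  rw [Submodule.map_sup, Submodule.mkQ_map_self, sup_bot_eq, Submodule.map_top,
    Submodule.range_mkQ, Submodule.map_span, ← Set.range_comp] at hquot
  refine ⟨Module.finite_def.2 (hquot ▸ Submodule.fg_span (Set.finite_range _)), ?_⟩
  rw [← finrank_top ℂ (_ ⧸ _), ← hquot]
  exact (finrank_range_le_card _).trans (by simp)
end

section
/- Let g be a finite-dimensional simple Lie algebra over C, x in g nonzero, and N a positive integer. Then the associative algebra U(g)/<x^N> is semisimple, i.e., every module over it is a direct sum of irreducible modules. -/
section Conjugation

open Polynomial

/-- A solution `p` of the differential equation `p' = [z, p]` with `p(0) = 0` vanishes. -/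
lemma Polynomial.eq_zero_of_derivative_eq_commutator {A : Type*} [Ring A] [Algebra ℚ A] (z : A)
    (p : A[X]) (hp : derivative p = C z * p - p * C z) (h0 : p.coeff 0 = 0) : p = 0 := by
  ext n
  induction n with
  | zero => simpa using h0
  | succ n ih =>
    have h := congrArg (fun q ↦ q.coeff n) hp
    simp only [coeff_derivative, coeff_sub, coeff_C_mul, coeff_mul_C, ih, coeff_zero, mul_zero,
      zero_mul, sub_zero] at h
    have hn : IsUnit ((n : A) + 1) := by
      have : ((n : ℚ) + 1) ≠ 0 := by positivity
      simpa using (IsUnit.mk0 _ this).map (algebraMap ℚ A)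
    simpa using (hn.mul_left_eq_zero).mp h

lemma Polynomial.derivative_pow_eq_commutator {A : Type*} [Ring A] (z : A)
    (p : A[X]) (hp : derivative p = C z * p - p * C z) (n : ℕ) :
    derivative (p ^ n) = C z * p ^ n - p ^ n * C z := by
  induction n with
  | zero => simp
  | succ n ih =>
    rw [pow_succ, derivative_mul, ih, hp]
    noncomm_ring

/-- If a vector-valued polynomial function takes values in a subspace, then so do its
coefficients. -/
lemma Submodule.mem_of_forall_sum_pow_smul_mem {K V : Type*} [Field K] [Infinite K]
    [AddCommGroup V] [Module K V] (W : Submodule K V) (n : ℕ) (v : ℕ → V)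
    (h : ∀ s : K, ∑ k ∈ Finset.range n, s ^ k • v k ∈ W) (k : ℕ) (hk : k < n) : v k ∈ W := by
  by_contra hv
  obtain ⟨φ, hφ, hW⟩ := W.exists_le_ker_of_notMem hv
  have hp : (∑ i ∈ Finset.range n, monomial i (φ (v i))) = 0 := by
    refine Polynomial.funext fun s ↦ ?_
    have := hW (h s)
    simp only [LinearMap.mem_ker, map_sum, map_smul, smul_eq_mul] at this
    simpa [eval_finsetSum, eval_monomial, mul_comm] using this
  have := congrArg (fun q ↦ q.coeff k) hp
  simp only [finsetSum_coeff, coeff_monomial, coeff_zero, Finset.sum_ite_eq', Finset.mem_range,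
    hk, if_true] at this
  exact hφ this

attribute [local instance] LieRing.ofAssociativeRing

variable {K L A : Type*} [Field K] [CharZero K] [LieRing L] [LieAlgebra K L] [Ring A] [Algebra K A]

open LieAlgebra in
/-- Conjugation by `exp (s • ad z)` preserves the relation `f y ^ N = 0`. -/
lemma LieHom.map_exp_ad_pow_eq_zero (f : L →ₗ⁅K⁆ A) {z : L} {n : ℕ} (hz : ad K L z ^ n = 0)
    {y : L} {N : ℕ} (hN : N ≠ 0) (hy : f y ^ N = 0) (s : K) :
    f (∑ k ∈ Finset.range n, s ^ k • (k.factorial : K)⁻¹ • (ad K L z ^ k) y) ^ N = 0 := by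
  let v : ℕ → L := fun k ↦ (k.factorial : K)⁻¹ • (ad K L z ^ k) y
  have hv0 : ∀ k, n ≤ k → v k = 0 := fun k hk ↦ by
    simp [v, pow_eq_zero_of_le hk hz]
  have hv (k : ℕ) : ((k : K) + 1) • v (k + 1) = ⁅z, v k⁆ := by
    have h : ((k : K) + 1) ≠ 0 := Nat.cast_add_one_ne_zero k
    simp only [v, lie_smul, pow_succ', Module.End.mul_apply, ad_apply, smul_smul,
      Nat.factorial_succ, Nat.cast_mul, Nat.cast_add, Nat.cast_one, mul_inv]
    rw [mul_inv_cancel_left₀ h]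
  let p : A[X] := ∑ k ∈ Finset.range n, monomial k (f (v k))
  have hpc (k : ℕ) : p.coeff k = f (v k) := by
    simp only [p, finsetSum_coeff, coeff_monomial, Finset.sum_ite_eq', Finset.mem_range]
    split_ifs with h
    · rfl
    · rw [hv0 k (not_lt.mp h), map_zero]
  have hp : derivative p = C (f z) * p - p * C (f z) := by
    ext k
    have h : f (((k : K) + 1) • v (k + 1)) = f (v (k + 1)) * ((k : A) + 1) := by
      rw [map_smul f ((k : K) + 1) (v (k + 1)), Algebra.smul_def, Algebra.commutes, map_add,
        map_natCast, map_one]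
    rw [coeff_derivative, coeff_sub, coeff_C_mul, coeff_mul_C, hpc, hpc,
      ← LieRing.of_associative_ring_bracket, ← LieHom.map_lie, ← hv, h]
  let : Algebra ℚ A := Algebra.compHom A (algebraMap ℚ K)
  have hpN : p ^ N = 0 := by
    refine eq_zero_of_derivative_eq_commutator (f z) _ (derivative_pow_eq_commutator _ _ hp N) ?_
    rcases n with _ | n
    · simp [p, hN]
    rw [show (p ^ N).coeff 0 = p.coeff 0 ^ N from map_pow (constantCoeff (R := A)) p N, hpc]
    simpa [v] using hy
  let e : A[X] →+* A := eval₂RingHom' (RingHom.id A) (algebraMap K A s)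
    fun a ↦ (Algebra.commutes s a).symm
  have he : e p = f (∑ k ∈ Finset.range n, s ^ k • v k) := by
    simp only [p, map_sum, map_smul]
    refine Finset.sum_congr rfl fun k _ ↦ ?_
    change eval₂ _ _ (monomial k _) = _
    rw [eval₂_monomial, Algebra.smul_def, map_pow, RingHom.id_apply, ← map_pow, Algebra.commutes]
  rw [← he, ← map_pow, hpN, map_zero]

end Conjugation

section RootVectors

open LieAlgebra LieModule

variable {K L : Type*} [Field K] [CharZero K] [IsAlgClosed K] [LieRing L] [LieAlgebra K L]
  [FiniteDimensional K L] [IsKilling K L]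

/-- A Lie subalgebra of a semisimple Lie algebra containing all ad-nilpotent elements is the
whole Lie algebra. -/
lemma LieSubalgebra.eq_top_of_forall_isNilpotent_ad_mem (S : LieSubalgebra K L)
    (hS : ∀ z, _root_.IsNilpotent (ad K L z) → z ∈ S) : S = ⊤ := by
  obtain ⟨x, hx⟩ := LieAlgebra.exists_isCartanSubalgebra_engel K L
  set H := LieSubalgebra.engel K x
  have hroot (χ : H → K) (hχ : χ ≠ 0) (z : L) (hz : z ∈ rootSpace H χ) : z ∈ S :=
    hS z (isNilpotent_ad_of_mem_rootSpace H hχ hz)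
  have hcartan (h : H) : (h : L) ∈ S := by
    suffices (⊤ : Submodule K H) ≤ S.toSubmodule.comap H.toSubmodule.subtype from this trivial
    rw [← LieSubmodule.top_toSubmodule (R := K) (L := H),
      ← LieAlgebra.IsKilling.biSup_corootSpace_eq_top (K := K) (L := L) (H := H)]
    simp only [LieSubmodule.iSup_toSubmodule, iSup_le_iff]
    intro α hα h hh
    have hα' : (α : H → K) ≠ 0 := hα
    refine (Submodule.span_le (p := S.toSubmodule)).mpr ?_
      ((mem_corootSpace (α := (α : H → K))).mp hh)
    rintro _ ⟨y, hy, z, hz, rfl⟩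
    exact S.lie_mem (hroot _ hα' y hy) (hroot _ (neg_ne_zero.mpr hα') z hz)
  rw [← LieSubalgebra.toSubmodule_inj, LieSubalgebra.top_toSubmodule, eq_top_iff,
    ← LieSubmodule.top_toSubmodule (R := K) (L := H),
    ← iSup_genWeightSpace_eq_top' K H L, LieSubmodule.iSup_toSubmodule, iSup_le_iff]
  intro α z hz
  by_cases hα : α.IsZero
  · have hz : z ∈ rootSpace H (α : H → K) := hz
    rw [hα, rootSpace_zero_eq] at hz
    exact hcartan ⟨z, hz⟩
  · exact hroot _ hα z hz

end RootVectors

section SpanningSet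

open LieAlgebra

attribute [local instance] LieRing.ofAssociativeRing

variable {K L A : Type*} [Field K] [CharZero K] [IsAlgClosed K] [LieRing L] [LieAlgebra K L]
  [FiniteDimensional K L] [LieAlgebra.IsSimple K L] [Ring A] [Algebra K A]

/-- If one nonzero element of a simple Lie algebra satisfies `f x ^ N = 0`, then the elements
satisfying this relation span the Lie algebra. -/
lemma LieHom.span_pow_eq_zero_eq_top (f : L →ₗ⁅K⁆ A) {x : L} (hx : x ≠ 0) {N : ℕ} (hN : N ≠ 0)
    (hfx : f x ^ N = 0) : Submodule.span K {y | f y ^ N = 0} = ⊤ := by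
  set V := Submodule.span K {y | f y ^ N = 0}
  let S : LieSubalgebra K L :=
    { carrier := {z | ∀ v ∈ V, ⁅z, v⁆ ∈ V}
      add_mem' := fun ha hb v hv ↦ by
        rw [add_lie]; exact V.add_mem (ha v hv) (hb v hv)
      zero_mem' := fun v _ ↦ by rw [zero_lie]; exact V.zero_mem
      smul_mem' := fun c a ha v hv ↦ by
        rw [smul_lie]; exact V.smul_mem c (ha v hv)
      lie_mem' := fun {a b} ha hb v hv ↦ by
        rw [lie_lie]; exact V.sub_mem (ha _ (hb v hv)) (hb _ (ha v hv)) }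
  have hS : S = ⊤ := by
    refine S.eq_top_of_forall_isNilpotent_ad_mem fun z ⟨n, hz⟩ v hv ↦ ?_
    replace hz : ad K L z ^ (n + 2) = 0 := pow_eq_zero_of_le (by lia) hz
    refine Submodule.span_induction (p := fun v _ ↦ ⁅z, v⁆ ∈ V) (fun y hy ↦ ?_) (by simp)
      (fun a b _ _ ha hb ↦ by rw [lie_add]; exact V.add_mem ha hb)
      (fun c a _ ha ↦ by rw [lie_smul]; exact V.smul_mem c ha) hv
    simpa using V.mem_of_forall_sum_pow_smul_mem (n + 2) _
      (fun s ↦ Submodule.subset_span (f.map_exp_ad_pow_eq_zero hz hN hy s)) 1 (by lia)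
  let I : LieIdeal K L :=
    { V with lie_mem := fun {z v} hv ↦ (hS ▸ LieSubalgebra.mem_top z : z ∈ S) v hv }
  have hxI : x ∈ I := Submodule.subset_span (s := {y | f y ^ N = 0}) hfx
  have hI : I = ⊤ := (LieAlgebra.IsSimple.eq_bot_or_eq_top I).resolve_left fun h ↦ hx <| by
    rwa [h, LieSubmodule.mem_bot] at hxI
  exact congrArg LieSubmodule.toSubmodule hI

end SpanningSet

section FiniteDimensional

attribute [local instance] LieRing.ofAssociativeRing

variable {K L A ι : Type*} [Field K] [LieRing L] [LieAlgebra K L] [Ring A] [Algebra K A]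

/-- The span of all products of fewer than `n` members of the family `y`. -/
def spanListProd (K : Type*) {A ι : Type*} [Field K] [Ring A] [Algebra K A] (y : ι → A) (n : ℕ) :
    Submodule K A :=
  Submodule.span K ((fun l : List ι ↦ (l.map y).prod) '' {l | l.length < n})

lemma prod_mem_spanListProd (y : ι → A) {n : ℕ} {l : List ι} (hl : l.length < n) :
    (l.map y).prod ∈ spanListProd K y n :=
  Submodule.subset_span ⟨l, hl, rfl⟩

lemma spanListProd_mono (y : ι → A) : Monotone (spanListProd K y) := fun _ _ hmn ↦
  Submodule.span_mono (Set.image_mono fun _ hl ↦ lt_of_lt_of_le hl hmn)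

lemma mul_mem_spanListProd (y : ι → A) {z w : A} (hz : z ∈ Submodule.span K (Set.range y)) {n : ℕ}
    (hw : w ∈ spanListProd K y n) : z * w ∈ spanListProd K y (n + 1) := by
  have hle : Submodule.span K (Set.range y) * spanListProd K y n ≤ spanListProd K y (n + 1) := by
    rw [spanListProd, Submodule.span_mul_span, Submodule.span_le]
    rintro _ ⟨_, ⟨i, rfl⟩, _, ⟨l, hl, rfl⟩, rfl⟩
    exact prod_mem_spanListProd (l := i :: l) y (by simpa using hl)
  exact hle (Submodule.mul_mem_mul hz hw)

/-- Reordering a product of elements of a Lie algebra only changes it by shorter products. -/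
lemma List.Perm.prod_sub_prod_mem_spanListProd (f : L →ₗ⁅K⁆ A) (b : Module.Basis ι K L)
    {l l' : List ι} (h : l.Perm l') :
    (l.map (f ∘ b)).prod - (l'.map (f ∘ b)).prod ∈ spanListProd K (f ∘ b) l.length := by
  have hf (z : L) : f z ∈ Submodule.span K (Set.range (f ∘ b)) := by
    have : (f : L →ₗ[K] A) z ∈ (⊤ : Submodule K L).map (f : L →ₗ[K] A) := ⟨z, trivial, rfl⟩
    rwa [← b.span_eq, Submodule.map_span, ← Set.range_comp] at this
  induction h with
  | nil => simp
  | cons a _ ih =>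
    simp only [List.map_cons, List.prod_cons, ← mul_sub, List.length_cons]
    exact mul_mem_spanListProd _ (Submodule.subset_span ⟨a, rfl⟩) ih
  | swap a c l =>
    have : (f (b c) * (f (b a) * (l.map (f ∘ b)).prod) -
        f (b a) * (f (b c) * (l.map (f ∘ b)).prod)) = f ⁅b c, b a⁆ * (l.map (f ∘ b)).prod := by
      rw [LieHom.map_lie, LieRing.of_associative_ring_bracket]
      noncomm_ring
    simp only [List.map_cons, List.prod_cons, List.length_cons, Function.comp_apply]
    rw [this]
    exact mul_mem_spanListProd _ (hf _) (prod_mem_spanListProd _ (Nat.lt_succ_self _))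
  | trans h₁ _ ih₁ ih₂ =>
    rw [← h₁.length_eq] at ih₂
    simpa using Submodule.add_mem _ ih₁ ih₂

lemma List.prod_mem_spanListProd_length [Fintype ι] (f : L →ₗ⁅K⁆ A) (b : Module.Basis ι K L)
    {N : ℕ} (hN : ∀ i, f (b i) ^ N = 0) {l : List ι} (hl : Fintype.card ι * N < l.length) :
    (l.map (f ∘ b)).prod ∈ spanListProd K (f ∘ b) l.length := by
  classical
  obtain ⟨i, hi⟩ : ∃ i, N ≤ l.count i := by
    by_contra! h
    have : l.length = ∑ i, l.count i := by
      simpa using (Multiset.sum_count_eq_card (s := Finset.univ) (m := (l : Multiset ι))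
        (by simp)).symm
    have := Finset.sum_le_card_nsmul Finset.univ (fun i ↦ l.count i) N fun i _ ↦ (h i).le
    simp only [Finset.card_univ, smul_eq_mul] at this
    lia
  obtain ⟨r, hr⟩ := (List.replicate_sublist_iff.mpr hi).exists_perm_append
  have h := hr.prod_sub_prod_mem_spanListProd f b
  simpa [hN] using h

/-- An algebra generated by a finite-dimensional Lie algebra with a basis of nilpotent elements is
finite-dimensional. -/
lemma LieHom.finite_of_basis_pow_eq_zero [Finite ι] (f : L →ₗ⁅K⁆ A)
    (hf : Algebra.adjoin K (Set.range f) = ⊤) (b : Module.Basis ι K L) {N : ℕ}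
    (hb : ∀ i, f (b i) ^ N = 0) : Module.Finite K A := by
  have := Fintype.ofFinite ι
  set y := f ∘ b
  set m := Fintype.card ι * N + 1
  have hsucc (n : ℕ) : spanListProd K y (m + n) ≤ spanListProd K y m := by
    induction n with
    | zero => rfl
    | succ n ih =>
      refine le_trans (Submodule.span_le.mpr ?_) ih
      rintro _ ⟨l, hl, rfl⟩
      rcases Nat.lt_or_ge l.length (m + n) with h | h
      · exact prod_mem_spanListProd _ h
      · have hl' : l.length < m + (n + 1) := hl
        exact spanListProd_mono _ (by lia) (List.prod_mem_spanListProd_length f b hb (by lia))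
  have hmul (a : A) : ∀ w ∈ spanListProd K y m, a * w ∈ spanListProd K y m := by
    have ha : a ∈ Algebra.adjoin K (Set.range f) := hf ▸ Algebra.mem_top
    induction ha using Algebra.adjoin_induction with
    | mem x hx =>
      obtain ⟨z, rfl⟩ := hx
      refine fun w hw ↦ hsucc 1 (mul_mem_spanListProd y ?_ hw)
      have : (f : L →ₗ[K] A) z ∈ (⊤ : Submodule K L).map (f : L →ₗ[K] A) := ⟨z, trivial, rfl⟩
      rwa [← b.span_eq, Submodule.map_span, ← Set.range_comp] at this
    | algebraMap r =>
      intro w hw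
      rw [← Algebra.smul_def]
      exact Submodule.smul_mem _ r hw
    | add a c _ _ ha hc => exact fun w hw ↦ add_mul a c w ▸ Submodule.add_mem _ (ha w hw) (hc w hw)
    | mul a c _ _ ha hc => exact fun w hw ↦ (mul_assoc a c w).symm ▸ ha _ (hc w hw)
  have htop : spanListProd K y m = ⊤ := by
    refine eq_top_iff.mpr fun a _ ↦ ?_
    have h1 : (1 : A) ∈ spanListProd K y m :=
      prod_mem_spanListProd (l := []) y (by simp [m])
    simpa using hmul a 1 h1
  refine ⟨htop ▸ Submodule.fg_span ?_⟩
  exact (List.finite_length_lt _ m).image _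

end FiniteDimensional

section NilpotentElement

attribute [local instance] LieRing.ofAssociativeRing

variable {K L A : Type*} [Field K] [CharZero K] [IsAlgClosed K] [LieRing L] [LieAlgebra K L]
  [FiniteDimensional K L] [LieAlgebra.IsSimple K L] [Ring A] [Algebra K A]

/-- An algebra generated by a simple Lie algebra one of whose nonzero elements is nilpotent is
finite-dimensional. -/
lemma LieHom.finite_of_pow_eq_zero (f : L →ₗ⁅K⁆ A)
    (hf : Algebra.adjoin K (Set.range f) = ⊤) {x : L} (hx : x ≠ 0) {N : ℕ} (hN : N ≠ 0)
    (hfx : f x ^ N = 0) : Module.Finite K A := by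
  have hV := f.span_pow_eq_zero_eq_top hx hN hfx
  let b := Module.Basis.ofSpan hV.ge
  have hb (i) : f (b i) ^ N = 0 := Module.Basis.ofSpan_subset hV.ge ⟨i, rfl⟩
  have := Module.Finite.finite_basis b
  exact f.finite_of_basis_pow_eq_zero hf b hb

end NilpotentElement

section Weyl

open LieAlgebra LieModule

section InvariantForm

variable {K L N ι : Type*} [Field K] [LieRing L] [LieAlgebra K L] [AddCommGroup N] [Module K N]
  [Fintype ι] [DecidableEq ι]

/-- The tensor `∑ bᵢ ⊗ bⁱ` attached to an invariant nondegenerate form is invariant. -/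
lemma LinearMap.BilinForm.sum_lie_dualBasis_eq_zero (B : LinearMap.BilinForm K L)
    (hB : B.Nondegenerate) (hs : B.IsSymm) (hinv : ∀ x y z : L, B ⁅x, y⁆ z = -B y ⁅x, z⁆)
    (b : Module.Basis ι K L) (φ : L →ₗ[K] L →ₗ[K] N) (x : L) :
    ∑ i, φ ⁅x, b i⁆ (B.dualBasis hB b i) + ∑ i, φ (b i) ⁅x, B.dualBasis hB b i⁆ = 0 := by
  set d := B.dualBasis hB b
  have hb (v : L) : v = ∑ j, B v (d j) • b j := by
    conv_lhs => rw [← b.sum_repr v]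
    refine Finset.sum_congr rfl fun j _ ↦ ?_
    conv_lhs => rw [← B.dualBasis_dualBasis hB hs b]
    rw [B.dualBasis_repr_apply, B.dualBasis_dualBasis hB hs b]
  have hd (v : L) : v = ∑ j, B v (b j) • d j := by
    conv_lhs => rw [← d.sum_repr v]
    simp only [d, B.dualBasis_repr_apply]
  have h₁ (i : ι) : φ ⁅x, b i⁆ (d i) = ∑ j, B ⁅x, b i⁆ (d j) • φ (b j) (d i) := by
    conv_lhs => rw [hb ⁅x, b i⁆]
    simp
  have h₂ (i : ι) : φ (b i) ⁅x, d i⁆ = ∑ j, B ⁅x, d i⁆ (b j) • φ (b i) (d j) := by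
    conv_lhs => rw [hd ⁅x, d i⁆]
    simp
  simp only [h₁, h₂]
  rw [Finset.sum_comm, ← Finset.sum_add_distrib]
  refine Finset.sum_eq_zero fun i _ ↦ ?_
  rw [← Finset.sum_add_distrib]
  refine Finset.sum_eq_zero fun j _ ↦ ?_
  rw [← add_smul, hinv x (d i), hs.eq, add_neg_cancel, zero_smul]

end InvariantForm

variable {K L : Type*} [Field K] [LieRing L] [LieAlgebra K L]

lemma LieAlgebra.IsSimple.lie_top_top [LieAlgebra.IsSimple K L] :
    ⁅(⊤ : LieIdeal K L), (⊤ : LieIdeal K L)⁆ = ⊤ := by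
  refine (LieAlgebra.IsSimple.eq_bot_or_eq_top _).resolve_left fun h ↦
    LieAlgebra.IsSimple.non_abelian K (L := L) ⟨fun x y ↦ ?_⟩
  have := LieSubmodule.lie_mem_lie (LieSubmodule.mem_top (R := K) (L := L) x)
    (LieSubmodule.mem_top (R := K) (L := L) y)
  rwa [h, LieSubmodule.mem_bot] at this

/-- A subspace of a simple Lie algebra containing all brackets is everything. -/
lemma LieAlgebra.IsSimple.mem_of_forall_lie_mem [LieAlgebra.IsSimple K L] (S : Submodule K L)
    (hS : ∀ x y : L, ⁅x, y⁆ ∈ S) (x : L) : x ∈ S := by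
  have h : x ∈ ⁅(⊤ : LieIdeal K L), (⊤ : LieIdeal K L)⁆ := by
    rw [LieAlgebra.IsSimple.lie_top_top]; exact LieSubmodule.mem_top x
  rw [← LieSubmodule.mem_toSubmodule, LieSubmodule.lieIdeal_oper_eq_linear_span'] at h
  refine Submodule.span_le.mpr ?_ h
  rintro _ ⟨y, -, z, -, rfl⟩
  exact hS y z

variable (K) in
lemma LieModule.isTrivial_of_isNilpotent_of_isSimple [LieAlgebra.IsSimple K L]
    (M : Type*) [AddCommGroup M] [Module K M] [LieRingModule L M] [LieModule K L M]
    [LieModule.IsNilpotent L M] : IsTrivial L M := by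
  have h (k : ℕ) : ∀ (x : L) (m : M), ⁅x, m⁆ ∈ lowerCentralSeries K L M k := by
    induction k with
    | zero => simp
    | succ k ih =>
      let S : Submodule K L := ⨅ m : M, (lowerCentralSeries K L M (k + 1)).toSubmodule.comap
        ((toEnd K L M : L →ₗ[K] Module.End K M).flip m)
      have hS : ∀ x y : L, ⁅x, y⁆ ∈ S := by
        refine fun x y ↦ (Submodule.mem_iInf _).mpr fun m ↦ ?_
        change ⁅⁅x, y⁆, m⁆ ∈ lowerCentralSeries K L M (k + 1)
        rw [lie_lie, lowerCentralSeries_succ]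
        exact sub_mem (LieSubmodule.lie_mem_lie (LieSubmodule.mem_top x) (ih y m))
          (LieSubmodule.lie_mem_lie (LieSubmodule.mem_top y) (ih x m))
      exact fun x m ↦ (Submodule.mem_iInf _).mp (LieAlgebra.IsSimple.mem_of_forall_lie_mem S hS x) m
  obtain ⟨k, hk⟩ := IsNilpotent.nilpotent K L M
  exact ⟨fun x m ↦ by simpa [hk] using h k x m⟩

variable [CharZero K] [FiniteDimensional K L] [LieAlgebra.IsSimple K L]

lemma LieModule.traceForm_nondegenerate_of_isSimple
    (M : Type*) [AddCommGroup M] [Module K M] [LieRingModule L M] [LieModule K L M]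
    [FiniteDimensional K M] (hM : ¬ IsTrivial L M) : (traceForm K L M).Nondegenerate := by
  rw [LinearMap.BilinForm.nondegenerate_iff_ker_eq_bot]
  let I : LieIdeal K L :=
    { LinearMap.ker (traceForm K L M) with
      lie_mem := fun {x y} hy ↦ by
        change traceForm K L M ⁅x, y⁆ = 0
        ext z
        rw [traceForm_apply_lie_apply', show traceForm K L M y = 0 from hy]
        simp }
  rcases LieAlgebra.IsSimple.eq_bot_or_eq_top I with h | h
  · exact congrArg LieSubmodule.toSubmodule h
  · refine absurd ?_ hM
    have h0 : traceForm K L M = 0 :=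
      LinearMap.ext fun x ↦ (h ▸ LieSubmodule.mem_top x : x ∈ I)
    have hnil := isNilpotent_derivedSeries_of_traceForm_eq_zero h0
    rw [isNilpotent_iff_forall' (R := K)] at hnil
    have hD : derivedSeries K L 1 = ⊤ := LieAlgebra.IsSimple.lie_top_top
    have : LieModule.IsNilpotent L M := (isNilpotent_iff_forall' (R := K)).mpr fun x ↦
      hnil ⟨x, hD ▸ LieSubmodule.mem_top x⟩
    exact isTrivial_of_isNilpotent_of_isSimple K M

/-- The Casimir element of a nontrivial representation of a simple Lie algebra acts by an
equivariant endomorphism which is not nilpotent and annihilates the first cohomology. -/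
lemma LieModule.exists_casimir
    (M : Type*) [AddCommGroup M] [Module K M] [LieRingModule L M] [LieModule K L M]
    [FiniteDimensional K M] (hM : ¬ IsTrivial L M) :
    ∃ c : Module.End K M, ¬ _root_.IsNilpotent c ∧ (∀ (x : L) (m : M), c ⁅x, m⁆ = ⁅x, c m⁆) ∧
      ∀ D : LieDerivation K L M, ∃ m : M, ∀ x : L, c (D x) = ⁅x, m⁆ := by
  have hB := traceForm_nondegenerate_of_isSimple (K := K) (L := L) M hM
  have hs : LinearMap.BilinForm.IsSymm (traceForm K L M) := ⟨traceForm_comm K L M⟩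
  let b := Module.finBasis K L
  let d := (traceForm K L M).dualBasis hB b
  have key (φ : L →ₗ[K] L →ₗ[K] M) (x : L) :
      ∑ i, φ ⁅x, b i⁆ (d i) + ∑ i, φ (b i) ⁅x, d i⁆ = 0 :=
    LinearMap.BilinForm.sum_lie_dualBasis_eq_zero _ hB hs (traceForm_apply_lie_apply' K L M) b φ x
  refine ⟨∑ i, toEnd K L M (b i) * toEnd K L M (d i), fun h ↦ ?_, fun x m ↦ ?_, fun D ↦
    ⟨∑ i, ⁅b i, D (d i)⁆, fun x ↦ ?_⟩⟩
  · have htr := (LinearMap.isNilpotent_trace_of_isNilpotent h).eq_zero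
    have hi (i) : LinearMap.trace K M (toEnd K L M (b i) * toEnd K L M (d i)) = 1 := by
      have := (traceForm K L M).apply_dualBasis_left hB b i i
      rw [traceForm_comm] at this
      rwa [if_pos rfl] at this
    simp only [map_sum, hi] at htr
    have := LieAlgebra.IsSimple.nontrivial K L
    have hr : (Module.finrank K L : K) ≠ 0 := Nat.cast_ne_zero.mpr Module.finrank_pos.ne'
    simp [hr] at htr
  · have h := key (LinearMap.mk₂ K (fun y z ↦ ⁅y, ⁅z, m⁆⁆) (by simp) (by simp) (by simp)
      (by simp)) x
    simp only [LinearMap.mk₂_apply, lie_lie, lie_sub, Finset.sum_sub_distrib] at h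
    simp only [LinearMap.sum_apply, Module.End.mul_apply, toEnd_apply_apply, lie_sum]
    rw [← sub_eq_zero, ← neg_eq_zero, ← h]
    abel
  · have h := key (LinearMap.mk₂ K (fun y z ↦ ⁅y, D z⁆) (by simp) (by simp) (by simp)
      (by simp)) x
    simp only [LinearMap.mk₂_apply, D.apply_lie_eq_sub, lie_lie, lie_sub,
      Finset.sum_sub_distrib] at h
    simp only [LinearMap.sum_apply, Module.End.mul_apply, toEnd_apply_apply, lie_sum]
    rw [← sub_eq_zero, ← neg_eq_zero, ← h]
    abel

/-- Whitehead's first lemma. -/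
theorem LieDerivation.exists_eq_lie_of_isSimple (n : ℕ)
    (M : Type*) [AddCommGroup M] [Module K M] [LieRingModule L M] [LieModule K L M]
    [FiniteDimensional K M] (hn : Module.finrank K M ≤ n) (D : LieDerivation K L M) :
    ∃ m : M, ∀ x : L, D x = ⁅x, m⁆ := by
  induction n using Nat.strong_induction_on generalizing M with
  | _ n ih =>
  by_cases hM : IsTrivial L M
  · refine ⟨0, fun x ↦ ?_⟩
    rw [lie_zero]
    refine LieAlgebra.IsSimple.mem_of_forall_lie_mem (LinearMap.ker (D : L →ₗ[K] M))
      (fun y z ↦ ?_) x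
    simp [D.apply_lie_eq_sub, trivial_lie_zero]
  obtain ⟨c, hc, hcomm, hD⟩ := exists_casimir (K := K) (L := L) M hM
  have hpow (k : ℕ) (x : L) (m : M) : (c ^ k) ⁅x, m⁆ = ⁅x, (c ^ k) m⁆ := by
    induction k with
    | zero => simp
    | succ k ih => rw [pow_succ', Module.End.mul_apply, ih, hcomm, Module.End.mul_apply]
  have hDpow (k : ℕ) : ∃ m : M, ∀ x : L, (c ^ (k + 1)) (D x) = ⁅x, m⁆ := by
    obtain ⟨m, hm⟩ := hD D
    exact ⟨(c ^ k) m, fun x ↦ by rw [pow_succ, Module.End.mul_apply, hm, hpow]⟩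
  obtain ⟨k, hk⟩ := ((Filter.tendsto_add_atTop_nat 1).eventually
    (LinearMap.eventually_isCompl_ker_pow_range_pow c)).exists
  obtain ⟨m, hm⟩ := hDpow k
  obtain ⟨u, hu, _, ⟨v, rfl⟩, rfl⟩ := Submodule.mem_sup.mp
    (hk.sup_eq_top ▸ Submodule.mem_top : m ∈ _)
  let M₀ : LieSubmodule K L M :=
    { LinearMap.ker (c ^ (k + 1)) with
      lie_mem := fun {x m} hm ↦ by
        change (c ^ (k + 1)) ⁅x, m⁆ = 0
        rw [hpow, show (c ^ (k + 1)) m = 0 from hm, lie_zero] }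
  have hM₀ : Module.finrank K M₀ < n := by
    refine lt_of_lt_of_le (Submodule.finrank_lt fun h ↦ hc ⟨k + 1, ?_⟩) hn
    exact LinearMap.ker_eq_top.mp h
  have hmem (x : L) : (D - LieDerivation.inner K L M v) x ∈ M₀ := by
    have h : (c ^ (k + 1)) (D x - ⁅x, v⁆) = ⁅x, u⁆ := by
      rw [map_sub, hm, hpow, lie_add, add_sub_cancel_right]
    have h0 : ⁅x, u⁆ ∈ LinearMap.ker (c ^ (k + 1)) ⊓ LinearMap.range (c ^ (k + 1)) :=
      ⟨M₀.lie_mem hu, ⟨_, h⟩⟩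
    rw [hk.inf_eq_bot, Submodule.mem_bot] at h0
    exact h.trans h0
  let D₀ : LieDerivation K L M₀ :=
    { toLinearMap := ((D - LieDerivation.inner K L M v : LieDerivation K L M) :
        L →ₗ[K] M).codRestrict _ hmem
      leibniz' := fun a b ↦ Subtype.ext ((D - LieDerivation.inner K L M v).apply_lie_eq_sub a b) }
  obtain ⟨w, hw⟩ := ih _ hM₀ M₀ le_rfl D₀
  refine ⟨v + w, fun x ↦ ?_⟩
  have hx : D x - ⁅x, v⁆ = ⁅x, (w : M)⁆ := congrArg Subtype.val (hw x)
  rw [lie_add, ← hx, add_sub_cancel]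

/-- Weyl's complete reducibility theorem for simple Lie algebras. -/
theorem LieSubmodule.exists_isCompl_of_isSimple
    (M : Type*) [AddCommGroup M] [Module K M] [LieRingModule L M] [LieModule K L M]
    [FiniteDimensional K M] (W : LieSubmodule K L M) : ∃ W' : LieSubmodule K L M,
      IsCompl W.toSubmodule W'.toSubmodule := by
  obtain ⟨p, hp⟩ := (W.incl : W →ₗ[K] M).exists_leftInverse_of_injective
    (Submodule.ker_subtype _)
  replace hp (w : W) : p w = w := LinearMap.congr_fun hp w
  let N : LieSubmodule K L (M →ₗ[K] W) :=
    { carrier := {h | ∀ w : W, h w = 0}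
      add_mem' := fun ha hb w ↦ by simp [ha w, hb w]
      zero_mem' := fun w ↦ rfl
      smul_mem' := fun c a ha w ↦ by simp [ha w]
      lie_mem := fun {x h} hh w ↦ by
        rw [LieHom.lie_apply, hh w, lie_zero, ← LieSubmodule.coe_bracket, hh, sub_zero] }
  have hmem (x : L) : LieDerivation.inner K L (M →ₗ[K] W) p x ∈ N := fun w ↦ by
    rw [LieDerivation.inner_apply_apply, LieHom.lie_apply, hp, ← LieSubmodule.coe_bracket, hp,
      sub_self]
  let D : LieDerivation K L N :=
    { toLinearMap :=
        (LieDerivation.inner K L (M →ₗ[K] W) p : L →ₗ[K] M →ₗ[K] W).codRestrict _ hmem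
      leibniz' := fun a b ↦ Subtype.ext
        ((LieDerivation.inner K L (M →ₗ[K] W) p).apply_lie_eq_sub a b) }
  obtain ⟨h, hh⟩ := LieDerivation.exists_eq_lie_of_isSimple _ N le_rfl D
  let q : M →ₗ[K] W := p - h
  have hq (x : L) (m : M) : q ⁅x, m⁆ = ⁅x, q m⁆ := by
    have this : ⁅x, p⁆ m = ⁅x, (h : M →ₗ[K] W)⁆ m :=
      LinearMap.congr_fun (congrArg Subtype.val (hh x)) m
    rw [LieHom.lie_apply, LieHom.lie_apply] at this
    simp only [q, LinearMap.sub_apply, lie_sub]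
    rw [sub_eq_sub_iff_sub_eq_sub] at this
    rw [← sub_eq_zero, ← neg_eq_zero, ← sub_eq_zero.mpr this]
    abel
  refine ⟨{ LinearMap.ker q with
    lie_mem := fun {x m} hm ↦ ?_ }, LinearMap.isCompl_of_proj (f := q) fun w ↦ ?_⟩
  · change q ⁅x, m⁆ = 0
    rw [hq, show q m = 0 from hm, lie_zero]
  · simp only [q, LinearMap.sub_apply]
    rw [hp, h.2 w, sub_zero]

end Weyl

section Semisimple

attribute [local instance] LieRing.ofAssociativeRing

variable {K L A : Type*} [Field K] [CharZero K] [LieRing L] [LieAlgebra K L]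
  [FiniteDimensional K L] [LieAlgebra.IsSimple K L] [Ring A] [Algebra K A]

/-- A finite-dimensional module over an algebra generated by a simple Lie algebra is semisimple. -/
lemma LieHom.isSemisimpleModule (f : L →ₗ⁅K⁆ A) (hf : Algebra.adjoin K (Set.range f) = ⊤)
    (M : Type*) [AddCommGroup M] [Module K M] [Module A M] [IsScalarTower K A M]
    [FiniteDimensional K M] : IsSemisimpleModule A M := by
  let _ : LieRingModule L M :=
    { bracket := fun x m ↦ f x • m
      add_lie := fun x y m ↦ by
        rw [map_add, add_smul]
      lie_add := fun x m n ↦ smul_add (f x) m n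
      leibniz_lie := fun x y m ↦ by
        change f x • f y • m = f ⁅x, y⁆ • m + f y • f x • m
        rw [f.map_lie, LieRing.of_associative_ring_bracket, sub_smul, mul_smul, mul_smul,
          sub_add_cancel] }
  have hsmul (x : L) (m : M) : ⁅x, m⁆ = f x • m := rfl
  have _ : LieModule K L M :=
    { smul_lie := fun t x m ↦ by rw [hsmul, hsmul, map_smul, smul_assoc]
      lie_smul := fun t x m ↦ by
        rw [hsmul, hsmul, ← algebraMap_smul A t m, ← algebraMap_smul A t (f x • m), smul_smul,
          smul_smul, Algebra.commutes] }
  refine { exists_isCompl := fun W ↦ ?_ }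
  obtain ⟨W', hW'⟩ := LieSubmodule.exists_isCompl_of_isSimple (K := K) (L := L) M
    { W.restrictScalars K with lie_mem := fun {x m} hm ↦ W.smul_mem (f x) hm }
  have hstable (a : A) : ∀ m ∈ W', a • m ∈ W' := by
    have ha : a ∈ Algebra.adjoin K (Set.range f) := hf ▸ Algebra.mem_top
    induction ha using Algebra.adjoin_induction with
    | mem x hx =>
      obtain ⟨z, rfl⟩ := hx
      exact fun m hm ↦ W'.lie_mem hm
    | algebraMap r => exact fun m hm ↦ (algebraMap_smul A r m).symm ▸ W'.smul_mem r hm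
    | add a c _ _ ha hc => exact fun m hm ↦ add_smul a c m ▸ W'.add_mem (ha m hm) (hc m hm)
    | mul a c _ _ ha hc => exact fun m hm ↦ mul_smul a c m ▸ ha _ (hc m hm)
  let V : Submodule A M := { W'.toSubmodule with smul_mem' := fun a m hm ↦ hstable a m hm }
  refine ⟨V, Submodule.disjoint_def.mpr fun m h₁ h₂ ↦
    Submodule.disjoint_def.mp hW'.disjoint m h₁ h₂, Submodule.codisjoint_iff_exists_add_eq.mpr
      fun m ↦ Submodule.codisjoint_iff_exists_add_eq.mp hW'.codisjoint m⟩

end Semisimple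

section EnvelopingAlgebra

attribute [local instance] LieRing.ofAssociativeRing

/-- The universal enveloping algebra is generated by the Lie algebra. -/
lemma UniversalEnvelopingAlgebra.adjoin_range_ι (R L : Type*) [CommRing R] [LieRing L]
    [LieAlgebra R L] :
    Algebra.adjoin R (Set.range (ι R : L → UniversalEnvelopingAlgebra R L)) = ⊤ := by
  let S := Algebra.adjoin R (Set.range (ι R : L → UniversalEnvelopingAlgebra R L))
  have hS (x : L) : ι R x ∈ S := Algebra.subset_adjoin ⟨x, rfl⟩
  let j : L →ₗ⁅R⁆ S :=
    { toFun := fun x ↦ ⟨ι R x, hS x⟩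
      map_add' := fun x y ↦ Subtype.ext (map_add _ x y)
      map_smul' := fun r x ↦ Subtype.ext (map_smul _ r x)
      map_lie' := fun {x y} ↦ Subtype.ext (LieHom.map_lie _ x y) }
  have h : S.val.comp (lift R j) = AlgHom.id R _ := by
    ext x
    simp [j]
  refine eq_top_iff.mpr fun a _ ↦ ?_
  have ha : (lift R j a : UniversalEnvelopingAlgebra R L) = a := DFunLike.congr_fun h a
  exact ha ▸ (lift R j a).2

/-- A quotient of the enveloping algebra of a simple Lie algebra in which some nonzero element of
the Lie algebra becomes nilpotent is semisimple. -/
lemma UniversalEnvelopingAlgebra.isSemisimpleRing_of_surjective {K L A : Type*} [Field K]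
    [CharZero K] [IsAlgClosed K] [LieRing L] [LieAlgebra K L] [FiniteDimensional K L]
    [LieAlgebra.IsSimple K L] [Ring A] [Algebra K A] (π : UniversalEnvelopingAlgebra K L →ₐ[K] A)
    (hπ : Function.Surjective π) {x : L} (hx : x ≠ 0) {N : ℕ} (hN : N ≠ 0)
    (hπx : π (ι K x ^ N) = 0) : IsSemisimpleRing A := by
  let f : L →ₗ⁅K⁆ A := π.toLieHom.comp (ι K)
  have hf : Algebra.adjoin K (Set.range f) = ⊤ := by
    rw [show Set.range f = π '' Set.range (ι K) from Set.range_comp π _, Algebra.adjoin_image,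
      adjoin_range_ι, Algebra.map_top, AlgHom.range_eq_top]
    exact hπ
  have := f.finite_of_pow_eq_zero hf hx hN ((map_pow π _ N).symm.trans hπx)
  exact f.isSemisimpleModule hf A

end EnvelopingAlgebra

/-- Let `g` be a finite-dimensional simple Lie algebra over `ℂ`, `x ≠ 0`
in `g`, and `N` a positive integer.  Then the associative algebra `U(g)/⟨x^N⟩` is
semisimple, i.e. every module over it is a direct sum of irreducible (simple) modules. -/
theorem enveloping_quotient_isSemisimpleRing
    {g : Type*} [LieRing g] [LieAlgebra ℂ g] [FiniteDimensional ℂ g]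
    [LieAlgebra.IsSimple ℂ g]
    (x : g) (hx : x ≠ 0) (N : ℕ) (hN : 0 < N) :
    IsSemisimpleRing
      ((TwoSidedIdeal.span {(UniversalEnvelopingAlgebra.ι ℂ x) ^ N}).ringCon.Quotient) := by
  refine UniversalEnvelopingAlgebra.isSemisimpleRing_of_surjective (RingCon.mkₐ ℂ _)
    (RingCon.mk'_surjective _) hx hN.ne' ((RingCon.eq _).mpr ?_)
  exact (TwoSidedIdeal.mem_iff _ _).mp (TwoSidedIdeal.subset_span rfl)
end
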